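/- Let H be a Hopf quasigroup over a field k. Then the category of right H-Hopf modules (right H-comodules M with φ_M: M ⊗ H → M satisfying φ_M(m⊗1)=m, ρ_M(φ_M(m⊗x)) = φ_M(m_[0]⊗x_(1)) ⊗ m_[1]x_(2), φ_M(φ_M(m⊗x_(1))⊗λ(x_(2))) = ε(x)m, φ_M(φ_M(m⊗λ(x_(1)))⊗x_(2)) = ε(x)m; morphisms are H-colinear maps f with f ∘ φ_M^ω = φ_N^ω ∘ (f ⊗ H) for the deformed actions) is equivalent to the category of k-vector spaces, via the functors N ↦ (N ⊗ H, id ⊗ μ_H, id ⊗ δ_H) and M ↦ M^{coH}. -/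

import Mathlib

open TensorProduct

noncomputable section

namespace DoiHopf

variable (k : Type) [Field k]
variable (H : Type) [AddCommGroup H] [Module k H]

/-- A Hopf quasigroup structure on `H`: a unital (not necessarily associative) magma and a
coassociative counital comonoid such that `eps` and `delta` are morphisms of unital magmas,
with an antipode `lam` satisfying the four Hopf quasigroup antipode identities. -/
structure IsHopfQuasigroup (mul : H ⊗[k] H →ₗ[k] H) (one : H)
    (eps : H →ₗ[k] k) (delta : H →ₗ[k] H ⊗[k] H) (lam : H →ₗ[k] H) : Prop where
  one_mul : ∀ x, mul (one ⊗ₜ[k] x) = x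
  mul_one : ∀ x, mul (x ⊗ₜ[k] one) = x
  coassoc : (TensorProduct.assoc k H H H).toLinearMap ∘ₗ delta.rTensor H ∘ₗ delta
      = delta.lTensor H ∘ₗ delta
  counit_left : ∀ x, (TensorProduct.lid k H) ((eps.rTensor H) (delta x)) = x
  counit_right : ∀ x, (TensorProduct.rid k H) ((eps.lTensor H) (delta x)) = x
  eps_mul : ∀ x y, eps (mul (x ⊗ₜ[k] y)) = eps x * eps y
  eps_one : eps one = 1
  delta_mul : delta ∘ₗ mul = (TensorProduct.map mul mul)
      ∘ₗ (TensorProduct.tensorTensorTensorComm k H H H H).toLinearMap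
      ∘ₗ (TensorProduct.map delta delta)
  delta_one : delta one = one ⊗ₜ[k] one
  antipode_left₁ : mul ∘ₗ (TensorProduct.map lam mul)
      ∘ₗ (TensorProduct.assoc k H H H).toLinearMap ∘ₗ delta.rTensor H
      = (TensorProduct.lid k H).toLinearMap ∘ₗ eps.rTensor H
  antipode_left₂ : mul ∘ₗ (TensorProduct.map (LinearMap.id : H →ₗ[k] H) (mul ∘ₗ lam.rTensor H))
      ∘ₗ (TensorProduct.assoc k H H H).toLinearMap ∘ₗ delta.rTensor H
      = (TensorProduct.lid k H).toLinearMap ∘ₗ eps.rTensor H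
  antipode_right₁ : mul ∘ₗ (TensorProduct.map mul lam)
      ∘ₗ (TensorProduct.assoc k H H H).symm.toLinearMap ∘ₗ delta.lTensor H
      = (TensorProduct.rid k H).toLinearMap ∘ₗ eps.lTensor H
  antipode_right₂ : mul ∘ₗ (TensorProduct.map (mul ∘ₗ lam.lTensor H) (LinearMap.id : H →ₗ[k] H))
      ∘ₗ (TensorProduct.assoc k H H H).symm.toLinearMap ∘ₗ delta.lTensor H
      = (TensorProduct.rid k H).toLinearMap ∘ₗ eps.lTensor H

/-- A right `H`-Hopf module in the sense of Brzeziński: a right `H`-comodule `(M, ρ_M)`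
with `φ_M : M ⊗ H → M` satisfying `φ_M(m ⊗ 1) = m`, the Hopf compatibility
`ρ_M(φ_M(m ⊗ x)) = φ_M(m₍₀₎ ⊗ x₍₁₎) ⊗ m₍₁₎x₍₂₎`, and the two cancellation laws
`φ_M(φ_M(m ⊗ x₍₁₎) ⊗ λ(x₍₂₎)) = ε(x)m` and `φ_M(φ_M(m ⊗ λ(x₍₁₎)) ⊗ x₍₂₎) = ε(x)m`. -/
structure IsHopfModule (mul : H ⊗[k] H →ₗ[k] H) (one : H)
    (eps : H →ₗ[k] k) (delta : H →ₗ[k] H ⊗[k] H) (lam : H →ₗ[k] H)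
    {M : Type} [AddCommGroup M] [Module k M]
    (phiM : M ⊗[k] H →ₗ[k] M) (rhoM : M →ₗ[k] M ⊗[k] H) : Prop where
  counit : ∀ m, (TensorProduct.rid k M) ((eps.lTensor M) (rhoM m)) = m
  coassoc : rhoM.rTensor H ∘ₗ rhoM
      = (TensorProduct.assoc k M H H).symm.toLinearMap ∘ₗ delta.lTensor M ∘ₗ rhoM
  act_one : ∀ m, phiM (m ⊗ₜ[k] one) = m
  compat : rhoM ∘ₗ phiM = (TensorProduct.map phiM mul)
      ∘ₗ (TensorProduct.tensorTensorTensorComm k M H H H).toLinearMap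
      ∘ₗ (TensorProduct.map rhoM delta)
  cancel₁ : phiM ∘ₗ (TensorProduct.map phiM lam)
      ∘ₗ (TensorProduct.assoc k M H H).symm.toLinearMap ∘ₗ delta.lTensor M
      = (TensorProduct.rid k M).toLinearMap ∘ₗ eps.lTensor M
  cancel₂ : phiM ∘ₗ (TensorProduct.map (phiM ∘ₗ lam.lTensor M) (LinearMap.id : H →ₗ[k] H))
      ∘ₗ (TensorProduct.assoc k M H H).symm.toLinearMap ∘ₗ delta.lTensor M
      = (TensorProduct.rid k M).toLinearMap ∘ₗ eps.lTensor M

/-- The coinvariant submodule `{m : ρ m = m ⊗ 1}`. -/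
def coinvSub {M : Type} [AddCommGroup M] [Module k M]
    (one : H) (rhoM : M →ₗ[k] M ⊗[k] H) : Submodule k M :=
  LinearMap.eqLocus rhoM ((TensorProduct.mk k M H).flip one)

variable (mul : H ⊗[k] H →ₗ[k] H) (one : H) (eps : H →ₗ[k] k)
variable (delta : H →ₗ[k] H ⊗[k] H) (lam : H →ₗ[k] H)

/-- An object of the category of right `H`-Hopf modules. -/
structure HopfMod where
  M : Type
  [ab : AddCommGroup M]
  [mo : Module k M]
  phi : M ⊗[k] H →ₗ[k] M
  rho : M →ₗ[k] M ⊗[k] H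
  ax : IsHopfModule k H mul one eps delta lam phi rho

attribute [instance] HopfMod.ab HopfMod.mo

variable {k H mul one eps delta lam}

/-- The canonical idempotent `q_M(m) = φ_M(m₍₀₎ ⊗ λ(m₍₁₎))`. -/
def HopfMod.q (X : HopfMod k H mul one eps delta lam) : X.M →ₗ[k] X.M :=
  X.phi ∘ₗ lam.lTensor X.M ∘ₗ X.rho

/-- The deformed action `φ^ω(m ⊗ x) = φ(q(m₍₀₎) ⊗ m₍₁₎·x)`. -/
def HopfMod.dphi (X : HopfMod k H mul one eps delta lam) : X.M ⊗[k] H →ₗ[k] X.M :=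
  X.phi ∘ₗ (TensorProduct.map X.q mul)
    ∘ₗ (TensorProduct.assoc k X.M H H).toLinearMap ∘ₗ X.rho.rTensor H

/-- Morphisms of Hopf modules are `H`-colinear maps which are `H`-quasilinear for the
deformed actions. -/
instance : CategoryTheory.Category (HopfMod k H mul one eps delta lam) where
  Hom X Y := {f : X.M →ₗ[k] Y.M //
    Y.rho ∘ₗ f = f.rTensor H ∘ₗ X.rho ∧ f ∘ₗ X.dphi = Y.dphi ∘ₗ f.rTensor H}
  id X := ⟨LinearMap.id, by simp⟩
  comp {X Y Z} f g := ⟨g.1 ∘ₗ f.1, by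
    obtain ⟨f, hf1, hf2⟩ := f
    obtain ⟨g, hg1, hg2⟩ := g
    constructor
    · apply LinearMap.ext; intro m
      have h1 := LinearMap.congr_fun hf1 m
      have h2 := LinearMap.congr_fun hg1 (f m)
      simp only [LinearMap.comp_apply, LinearMap.rTensor_comp] at h1 h2 ⊢
      rw [h2, h1]
    · apply LinearMap.ext; intro t
      have h1 := LinearMap.congr_fun hf2 t
      have h2 := LinearMap.congr_fun hg2 (LinearMap.rTensor H f t)
      simp only [LinearMap.comp_apply, LinearMap.rTensor_comp] at h1 h2 ⊢
      rw [h1, h2]⟩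
  id_comp f := Subtype.ext (LinearMap.comp_id f.1)
  comp_id f := Subtype.ext (LinearMap.id_comp f.1)
  assoc f g h := Subtype.ext rfl

namespace IsHopfQuasigroup

theorem lam_one (hH : IsHopfQuasigroup k H mul one eps delta lam) : lam one = one := by
  have h := LinearMap.congr_fun hH.antipode_left₁ (one ⊗ₜ[k] one)
  simpa [hH.delta_one, hH.mul_one, hH.eps_one] using h

/-- The iterated coproduct `x₍₁₎ ⊗ ((x₍₂₎ ⊗ x₍₃₎) ⊗ x₍₄₎)` computed in two ways. -/
theorem delta_delta (hH : IsHopfQuasigroup k H mul one eps delta lam) (x : H) :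
    ((TensorProduct.assoc k H H H).symm.toLinearMap.lTensor H)
      (TensorProduct.assoc k H H (H ⊗[k] H) (TensorProduct.map delta delta (delta x)))
    = (delta.rTensor H ∘ₗ delta).lTensor H (delta x) := by
  have hslide : ∀ t : H ⊗[k] H,
      TensorProduct.assoc k H H (H ⊗[k] H) (TensorProduct.map delta delta t)
        = (delta.lTensor H).lTensor H (TensorProduct.assoc k H H H (delta.rTensor H t)) := by
    intro t
    induction t with
    | zero => simp
    | add s t hs ht => simp only [map_add, hs, ht]
    | tmul a b =>
      simp only [TensorProduct.map_tmul, LinearMap.rTensor_tmul]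
      generalize delta a = u
      induction u with
      | zero => simp
      | add s t hs ht => simp only [map_add, TensorProduct.add_tmul, hs, ht]
      | tmul c d => simp
  have hco := LinearMap.congr_fun hH.coassoc x
  simp only [LinearMap.comp_apply, LinearEquiv.coe_coe] at hco
  have hco' : (TensorProduct.assoc k H H H).symm.toLinearMap ∘ₗ delta.lTensor H ∘ₗ delta
      = delta.rTensor H ∘ₗ delta := by
    rw [← hH.coassoc]
    ext; simp
  rw [hslide, hco, ← hco']
  simp only [LinearMap.lTensor_comp, LinearMap.comp_apply]

end IsHopfQuasigroup

/-- The action of `H ⊗ H` on `M ⊗ H` induced by an action of `H` on `M` and the product of `H`. -/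
def tensorAct {M : Type} [AddCommGroup M] [Module k M] (mul : H ⊗[k] H →ₗ[k] H)
    (phi : M ⊗[k] H →ₗ[k] M) : (M ⊗[k] H) ⊗[k] (H ⊗[k] H) →ₗ[k] M ⊗[k] H :=
  TensorProduct.map phi mul ∘ₗ (TensorProduct.tensorTensorTensorComm k M H H H).toLinearMap

@[simp]
theorem tensorAct_tmul {M : Type} [AddCommGroup M] [Module k M]
    (phi : M ⊗[k] H →ₗ[k] M) (m : M) (h a b : H) :
    tensorAct mul phi ((m ⊗ₜ h) ⊗ₜ (a ⊗ₜ b)) = phi (m ⊗ₜ a) ⊗ₜ mul (h ⊗ₜ b) := by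
  simp [tensorAct]

namespace HopfMod

theorem rho_phi (X : HopfMod k H mul one eps delta lam) (m : X.M) (x : H) :
    X.rho (X.phi (m ⊗ₜ x)) = tensorAct mul X.phi (X.rho m ⊗ₜ delta x) :=
  LinearMap.congr_fun X.ax.compat (m ⊗ₜ x)

theorem rho_rho (X : HopfMod k H mul one eps delta lam) (m : X.M) :
    X.rho.rTensor H (X.rho m)
      = (TensorProduct.assoc k X.M H H).symm (delta.lTensor X.M (X.rho m)) :=
  LinearMap.congr_fun X.ax.coassoc m

theorem phi_q_rho (X : HopfMod k H mul one eps delta lam) (m : X.M) :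
    X.phi (X.q.rTensor H (X.rho m)) = m := by
  have h := LinearMap.congr_fun X.ax.cancel₂ (X.rho m)
  simp only [LinearMap.comp_apply, LinearEquiv.coe_coe, X.ax.counit, ← X.rho_rho] at h
  conv_rhs => rw [← h]
  simp only [q, ← LinearMap.comp_assoc, LinearMap.rTensor_comp _ _ X.rho, LinearMap.comp_apply]
  rfl

/-- The cancellation law `(v · δ(x₍₁₎)) · (λ(x₍₃₎) ⊗ λ(x₍₂₎)) = ε(x)v` for the action of `H ⊗ H`
on `M ⊗ H`. -/
theorem tensorAct_cancel (hH : IsHopfQuasigroup k H mul one eps delta lam)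
    (X : HopfMod k H mul one eps delta lam) (v : X.M ⊗[k] H) (x : H) :
    tensorAct mul X.phi (TensorProduct.map (tensorAct mul X.phi ∘ₗ TensorProduct.mk k _ _ v)
      (TensorProduct.map lam lam ∘ₗ (TensorProduct.comm k H H).toLinearMap)
      (TensorProduct.map delta delta (delta x))) = eps x • v := by
  induction v with
  | zero => simp
  | add v w hv hw =>
    rw [smul_add, ← hv, ← hw, map_add, LinearMap.comp_add, TensorProduct.map_add_left,
      LinearMap.add_apply, map_add]
  | tmul m h =>
    let A : H ⊗[k] H →ₗ[k] X.M :=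
      X.phi ∘ₗ TensorProduct.map (X.phi ∘ₗ TensorProduct.mk k _ _ m) lam
    let B : H ⊗[k] H →ₗ[k] H :=
      mul ∘ₗ TensorProduct.map (mul ∘ₗ TensorProduct.mk k _ _ h) lam
    let K : H ⊗[k] ((H ⊗[k] H) ⊗[k] H) →ₗ[k] X.M ⊗[k] H :=
      TensorProduct.map A B ∘ₗ (TensorProduct.assoc k H H (H ⊗[k] H)).symm.toLinearMap
        ∘ₗ (TensorProduct.comm k (H ⊗[k] H) H).toLinearMap.lTensor H
    have hA : ∀ y, A (delta y) = eps y • m := by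
      intro y
      have e := LinearMap.congr_fun X.ax.cancel₁ (m ⊗ₜ y)
      simp only [LinearMap.comp_apply, LinearEquiv.coe_coe, LinearMap.lTensor_tmul,
        TensorProduct.rid_tmul] at e
      rw [← e]
      generalize delta y = u
      induction u with
      | zero => simp
      | add s t hs ht => simp only [map_add, TensorProduct.tmul_add, hs, ht]
      | tmul c d => simp [A]
    have hB : ∀ y, B (delta y) = eps y • h := by
      intro y
      have e := LinearMap.congr_fun hH.antipode_right₁ (h ⊗ₜ y)
      simp only [LinearMap.comp_apply, LinearEquiv.coe_coe, LinearMap.lTensor_tmul,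
        TensorProduct.rid_tmul] at e
      rw [← e]
      generalize delta y = u
      induction u with
      | zero => simp
      | add s t hs ht => simp only [map_add, TensorProduct.tmul_add, hs, ht]
      | tmul c d => simp [B]
    have hK : tensorAct mul X.phi ∘ₗ
        TensorProduct.map (tensorAct mul X.phi ∘ₗ TensorProduct.mk k _ _ (m ⊗ₜ h))
          (TensorProduct.map lam lam ∘ₗ (TensorProduct.comm k H H).toLinearMap)
        = K ∘ₗ (TensorProduct.assoc k H H H).symm.toLinearMap.lTensor H
          ∘ₗ (TensorProduct.assoc k H H (H ⊗[k] H)).toLinearMap := by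
      ext a b c d
      simp [K, A, B]
    have hmid : K ∘ₗ (delta.rTensor H ∘ₗ delta).lTensor H
        = (TensorProduct.mk k X.M H).flip h ∘ₗ A := by
      have hrt : ∀ (a : H) (u : H ⊗[k] H), K (a ⊗ₜ delta.rTensor H u)
          = A (a ⊗ₜ (TensorProduct.lid k H (eps.rTensor H u))) ⊗ₜ h := by
        intro a u
        induction u with
        | zero => simp
        | add s t hs ht =>
          simp only [map_add, TensorProduct.tmul_add, TensorProduct.add_tmul, hs, ht]
        | tmul c d => simp [K, hB, TensorProduct.smul_tmul]
      ext a b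
      simp [hrt, hH.counit_left]
    have e := LinearMap.congr_fun hK (TensorProduct.map delta delta (delta x))
    simp only [LinearMap.comp_apply, LinearEquiv.coe_coe] at e
    rw [e, hH.delta_delta x]
    have e' := LinearMap.congr_fun hmid (delta x)
    rw [LinearMap.comp_apply] at e'
    rw [e', LinearMap.comp_apply, hA]
    simp [TensorProduct.smul_tmul']

/-- A linear map `f : M → M ⊗ H` is determined by `m ↦ f(m₍₀₎) · δ(m₍₁₎)`. -/
theorem eq_of_tensorAct_eq (hH : IsHopfQuasigroup k H mul one eps delta lam)
    (X : HopfMod k H mul one eps delta lam) {f g : X.M →ₗ[k] X.M ⊗[k] H}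
    (h : ∀ m, tensorAct mul X.phi (TensorProduct.map f delta (X.rho m))
      = tensorAct mul X.phi (TensorProduct.map g delta (X.rho m))) : f = g := by
  let L : H →ₗ[k] H ⊗[k] H :=
    TensorProduct.map lam lam ∘ₗ (TensorProduct.comm k H H).toLinearMap ∘ₗ delta
  have key : ∀ (f : X.M →ₗ[k] X.M ⊗[k] H) (m : X.M),
      tensorAct mul X.phi (TensorProduct.map
        (tensorAct mul X.phi ∘ₗ TensorProduct.map f delta ∘ₗ X.rho) L (X.rho m)) = f m := by
    intro f m
    have e1 : TensorProduct.map
        (tensorAct mul X.phi ∘ₗ TensorProduct.map f delta ∘ₗ X.rho) L (X.rho m)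
        = TensorProduct.map (tensorAct mul X.phi ∘ₗ TensorProduct.map f delta) L
          (X.rho.rTensor H (X.rho m)) := by
      generalize X.rho m = u
      induction u with
      | zero => simp
      | add s t hs ht => simp only [map_add, hs, ht]
      | tmul c d => simp
    rw [e1, X.rho_rho]
    conv_rhs => rw [← X.ax.counit m]
    generalize X.rho m = u
    induction u with
    | zero => simp
    | add s t hs ht => simp only [map_add, hs, ht]
    | tmul c d =>
      rw [LinearMap.lTensor_tmul, LinearMap.lTensor_tmul, TensorProduct.rid_tmul, map_smul,
        ← X.tensorAct_cancel hH]
      congr 1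
      generalize delta d = w
      induction w with
      | zero => simp
      | add s t hs ht => simp only [map_add, TensorProduct.tmul_add, hs, ht]
      | tmul c d => simp [L]
  ext1 m
  rw [← key f m, ← key g m]
  congr 3
  ext1 n
  exact h n

theorem rho_q (hH : IsHopfQuasigroup k H mul one eps delta lam)
    (X : HopfMod k H mul one eps delta lam) (m : X.M) : X.rho (X.q m) = X.q m ⊗ₜ one := by
  suffices X.rho ∘ₗ X.q = (TensorProduct.mk k X.M H).flip one ∘ₗ X.q from
    LinearMap.congr_fun this m
  refine X.eq_of_tensorAct_eq hH fun m => ?_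
  have e1 : tensorAct mul X.phi (TensorProduct.map (X.rho ∘ₗ X.q) delta (X.rho m)) = X.rho m := by
    conv_rhs => rw [← X.phi_q_rho m]
    generalize X.rho m = u
    induction u with
    | zero => simp
    | add s t hs ht => simp only [map_add, hs, ht]
    | tmul c d => simp [rho_phi]
  have e2 : tensorAct mul X.phi
      (TensorProduct.map ((TensorProduct.mk k X.M H).flip one ∘ₗ X.q) delta (X.rho m))
      = (X.phi ∘ₗ X.q.rTensor H).rTensor H (X.rho.rTensor H (X.rho m)) := by
    rw [X.rho_rho]
    generalize X.rho m = u
    induction u with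
    | zero => simp
    | add s t hs ht => simp only [map_add, hs, ht]
    | tmul c d =>
      simp only [TensorProduct.map_tmul, LinearMap.lTensor_tmul]
      generalize delta d = w
      induction w with
      | zero => simp
      | add s t hs ht => simp only [map_add, TensorProduct.tmul_add, hs, ht]
      | tmul a b => simp [hH.one_mul]
  have e3 : X.phi ∘ₗ X.q.rTensor H ∘ₗ X.rho = LinearMap.id := LinearMap.ext X.phi_q_rho
  rw [e1, e2, ← LinearMap.comp_apply (LinearMap.rTensor H _), ← LinearMap.rTensor_comp,
    LinearMap.comp_assoc, e3, LinearMap.rTensor_id, LinearMap.id_apply]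

/-- The coinvariants of a Hopf module. -/
abbrev coinv (X : HopfMod k H mul one eps delta lam) : Submodule k X.M :=
  coinvSub k H one X.rho

theorem rho_coinv (X : HopfMod k H mul one eps delta lam) (n : X.coinv) :
    X.rho n = (n : X.M) ⊗ₜ one :=
  n.2

theorem rho_phi_coinv (hH : IsHopfQuasigroup k H mul one eps delta lam)
    (X : HopfMod k H mul one eps delta lam) (n : X.coinv) (x : H) :
    X.rho (X.phi ((n : X.M) ⊗ₜ x))
      = (X.phi ∘ₗ TensorProduct.mk k X.M H n).rTensor H (delta x) := by
  rw [rho_phi, rho_coinv]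
  generalize delta x = w
  induction w with
  | zero => simp
  | add s t hs ht => simp only [map_add, TensorProduct.tmul_add, hs, ht]
  | tmul a b => simp [hH.one_mul]

theorem q_phi_coinv (hH : IsHopfQuasigroup k H mul one eps delta lam)
    (X : HopfMod k H mul one eps delta lam) (n : X.coinv) (x : H) :
    X.q (X.phi ((n : X.M) ⊗ₜ x)) = eps x • (n : X.M) := by
  have e := LinearMap.congr_fun X.ax.cancel₁ ((n : X.M) ⊗ₜ x)
  simp only [LinearMap.comp_apply, LinearEquiv.coe_coe, LinearMap.lTensor_tmul,
    TensorProduct.rid_tmul] at e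
  rw [← e, q, LinearMap.comp_apply, LinearMap.comp_apply, X.rho_phi_coinv hH]
  generalize delta x = w
  induction w with
  | zero => simp
  | add s t hs ht => simp only [map_add, TensorProduct.tmul_add, hs, ht]
  | tmul a b => simp

/-- The projection `p_M : M → M^{coH}`. -/
def p (hH : IsHopfQuasigroup k H mul one eps delta lam)
    (X : HopfMod k H mul one eps delta lam) : X.M →ₗ[k] X.coinv :=
  X.q.codRestrict X.coinv (X.rho_q hH)

/-- The canonical isomorphism `ω_M : M^{coH} ⊗ H → M`. -/
def omega (hH : IsHopfQuasigroup k H mul one eps delta lam)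
    (X : HopfMod k H mul one eps delta lam) : X.coinv ⊗[k] H ≃ₗ[k] X.M :=
  LinearEquiv.ofLinearMap (X.phi ∘ₗ X.coinv.subtype.rTensor H) ((X.p hH).rTensor H ∘ₗ X.rho)
    (by
      ext1 m
      simp only [LinearMap.comp_apply, LinearMap.id_apply]
      rw [← LinearMap.comp_apply (LinearMap.rTensor H _), ← LinearMap.rTensor_comp]
      exact X.phi_q_rho m)
    (by
      ext n x
      have hp : ∀ w : H ⊗[k] H, (X.p hH).rTensor H
          ((X.phi ∘ₗ TensorProduct.mk k X.M H n).rTensor H w)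
          = n ⊗ₜ TensorProduct.lid k H (eps.rTensor H w) := by
        intro w
        induction w with
        | zero => simp
        | add s t hs ht => simp only [map_add, TensorProduct.tmul_add, hs, ht]
        | tmul a b =>
          have : X.p hH (X.phi ((n : X.M) ⊗ₜ a)) = eps a • n :=
            Subtype.ext (X.q_phi_coinv hH n a)
          simp [this, TensorProduct.smul_tmul]
      simp [X.rho_phi_coinv hH, hp, hH.counit_left])

@[simp]
theorem omega_tmul (hH : IsHopfQuasigroup k H mul one eps delta lam)
    (X : HopfMod k H mul one eps delta lam) (n : X.coinv) (x : H) :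
    X.omega hH (n ⊗ₜ x) = X.phi ((n : X.M) ⊗ₜ x) := by
  simp [omega]

theorem rho_omega (hH : IsHopfQuasigroup k H mul one eps delta lam)
    (X : HopfMod k H mul one eps delta lam) (n : X.coinv) (x : H) :
    X.rho (X.omega hH (n ⊗ₜ x))
      = ((X.omega hH).toLinearMap ∘ₗ TensorProduct.mk k X.coinv H n).rTensor H (delta x) := by
  rw [omega_tmul, X.rho_phi_coinv hH]
  congr 2

theorem dphi_omega (hH : IsHopfQuasigroup k H mul one eps delta lam)
    (X : HopfMod k H mul one eps delta lam) (n : X.coinv) (x y : H) :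
    X.dphi (X.omega hH (n ⊗ₜ x) ⊗ₜ y) = X.omega hH (n ⊗ₜ mul (x ⊗ₜ y)) := by
  rw [omega_tmul, omega_tmul, dphi]
  simp only [LinearMap.comp_apply, LinearMap.rTensor_tmul, X.rho_phi_coinv hH]
  conv_rhs => rw [← hH.counit_left x]
  generalize delta x = w
  congr 1
  induction w with
  | zero => simp
  | add s t hs ht => simp only [map_add, TensorProduct.tmul_add, TensorProduct.add_tmul, hs, ht]
  | tmul a b => simp [X.q_phi_coinv hH, TensorProduct.smul_tmul, TensorProduct.tmul_smul]

theorem dphi_coinv (hH : IsHopfQuasigroup k H mul one eps delta lam)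
    (X : HopfMod k H mul one eps delta lam) (n : X.coinv) (x : H) :
    X.dphi ((n : X.M) ⊗ₜ x) = X.omega hH (n ⊗ₜ x) := by
  have h := X.dphi_omega hH n one x
  rwa [omega_tmul, X.ax.act_one, hH.one_mul] at h

/-- The free Hopf module `(N ⊗ H, id ⊗ μ, id ⊗ δ)`. -/
def free (hH : IsHopfQuasigroup k H mul one eps delta lam) (N : Type) [AddCommGroup N]
    [Module k N] : HopfMod k H mul one eps delta lam where
  M := N ⊗[k] H
  phi := mul.lTensor N ∘ₗ (TensorProduct.assoc k N H H).toLinearMap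
  rho := (TensorProduct.assoc k N H H).symm.toLinearMap ∘ₗ delta.lTensor N
  ax :=
    { counit := by
        intro m
        induction m with
        | zero => simp
        | add s t hs ht => simp only [map_add, hs, ht]
        | tmul n x =>
          conv_rhs => rw [← hH.counit_right x]
          simp only [LinearMap.comp_apply, LinearMap.lTensor_tmul]
          generalize delta x = w
          induction w with
          | zero => simp
          | add s t hs ht => simp only [map_add, TensorProduct.tmul_add, hs, ht]
          | tmul a b => simp
      coassoc := by
        ext n x
        have hco := LinearMap.congr_fun hH.coassoc x
        simp only [LinearMap.comp_apply, LinearEquiv.coe_coe] at hco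
        have e1 : ∀ w : H ⊗[k] H,
            ((TensorProduct.assoc k N H H).symm.toLinearMap ∘ₗ delta.lTensor N).rTensor H
              ((TensorProduct.assoc k N H H).symm (n ⊗ₜ w))
            = (TensorProduct.assoc k N H H).symm.toLinearMap.rTensor H
              ((TensorProduct.assoc k N (H ⊗[k] H) H).symm (n ⊗ₜ delta.rTensor H w)) := by
          intro w
          induction w with
          | zero => simp
          | add s t hs ht => simp only [map_add, TensorProduct.tmul_add, hs, ht]
          | tmul a b => simp
        have e2 : ∀ w : H ⊗[k] H,
            delta.lTensor (N ⊗[k] H) ((TensorProduct.assoc k N H H).symm (n ⊗ₜ w))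
            = (TensorProduct.assoc k N H (H ⊗[k] H)).symm (n ⊗ₜ delta.lTensor H w) := by
          intro w
          induction w with
          | zero => simp
          | add s t hs ht => simp only [map_add, TensorProduct.tmul_add, hs, ht]
          | tmul a b => simp
        have e3 : ∀ w : (H ⊗[k] H) ⊗[k] H,
            (TensorProduct.assoc k N H H).symm.toLinearMap.rTensor H
              ((TensorProduct.assoc k N (H ⊗[k] H) H).symm (n ⊗ₜ w))
            = (TensorProduct.assoc k (N ⊗[k] H) H H).symm
              ((TensorProduct.assoc k N H (H ⊗[k] H)).symm
                (n ⊗ₜ TensorProduct.assoc k H H H w)) := by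
          intro w
          induction w with
          | zero => simp
          | add s t hs ht => simp only [map_add, TensorProduct.tmul_add, hs, ht]
          | tmul u c =>
            induction u with
            | zero => simp
            | add s t hs ht =>
              simp only [map_add, TensorProduct.tmul_add, TensorProduct.add_tmul, hs, ht]
            | tmul a b => simp
        simp only [TensorProduct.AlgebraTensorModule.curry_apply, LinearMap.restrictScalars_self,
          TensorProduct.curry_apply, LinearMap.comp_apply, LinearMap.lTensor_tmul,
          LinearEquiv.coe_coe]
        rw [e1, e2, e3, hco]
      act_one := by
        intro m
        induction m with
        | zero => simp
        | add s t hs ht => simp only [map_add, TensorProduct.add_tmul, hs, ht]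
        | tmul n x => simp [hH.mul_one]
      compat := by
        ext n x y
        have h := LinearMap.congr_fun hH.delta_mul (x ⊗ₜ y)
        simp only [LinearMap.comp_apply, LinearEquiv.coe_coe, TensorProduct.map_tmul] at h
        simp only [TensorProduct.AlgebraTensorModule.curry_apply, LinearMap.restrictScalars_self,
          TensorProduct.curry_apply, LinearMap.comp_apply, LinearMap.lTensor_tmul,
          LinearEquiv.coe_coe, TensorProduct.assoc_tmul, h, TensorProduct.map_tmul]
        generalize delta x = u
        generalize delta y = v
        induction u with
        | zero => simp
        | add s t hs ht =>
          simp only [map_add, TensorProduct.tmul_add, TensorProduct.add_tmul, hs, ht]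
        | tmul a b =>
          induction v with
          | zero => simp
          | add s t hs ht =>
            simp only [map_add, TensorProduct.tmul_add, hs, ht]
          | tmul c d => simp
      cancel₁ := by
        ext n x y
        have h := LinearMap.congr_fun hH.antipode_right₁ (x ⊗ₜ y)
        simp only [LinearMap.comp_apply, LinearEquiv.coe_coe, LinearMap.lTensor_tmul,
          TensorProduct.rid_tmul] at h
        simp only [TensorProduct.AlgebraTensorModule.curry_apply, LinearMap.restrictScalars_self,
          TensorProduct.curry_apply, LinearMap.comp_apply, LinearMap.lTensor_tmul,
          LinearEquiv.coe_coe, TensorProduct.rid_tmul, ← TensorProduct.tmul_smul, ← h]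
        generalize delta y = w
        induction w with
        | zero => simp
        | add s t hs ht => simp only [map_add, TensorProduct.tmul_add, hs, ht]
        | tmul a b => simp
      cancel₂ := by
        ext n x y
        have h := LinearMap.congr_fun hH.antipode_right₂ (x ⊗ₜ y)
        simp only [LinearMap.comp_apply, LinearEquiv.coe_coe, LinearMap.lTensor_tmul,
          TensorProduct.rid_tmul] at h
        simp only [TensorProduct.AlgebraTensorModule.curry_apply, LinearMap.restrictScalars_self,
          TensorProduct.curry_apply, LinearMap.comp_apply, LinearMap.lTensor_tmul,
          LinearEquiv.coe_coe, TensorProduct.rid_tmul, ← TensorProduct.tmul_smul, ← h]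
        generalize delta y = w
        induction w with
        | zero => simp
        | add s t hs ht => simp only [map_add, TensorProduct.tmul_add, hs, ht]
        | tmul a b => simp }

/-- The unit isomorphism `N ≃ (N ⊗ H)^{coH}`, `n ↦ n ⊗ 1`. -/
def freeCoinvEquiv (hH : IsHopfQuasigroup k H mul one eps delta lam) (N : Type) [AddCommGroup N]
    [Module k N] : (free hH N).coinv ≃ₗ[k] N :=
  LinearEquiv.ofLinearMap
    ((TensorProduct.rid k N).toLinearMap ∘ₗ eps.lTensor N ∘ₗ (free hH N).coinv.subtype)
    (((TensorProduct.mk k N H).flip one).codRestrict (free hH N).coinv fun n => by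
      change (TensorProduct.assoc k N H H).symm (n ⊗ₜ delta one) = (n ⊗ₜ one) ⊗ₜ one
      rw [hH.delta_one, TensorProduct.assoc_symm_tmul])
    (by
      ext n
      change TensorProduct.rid k N (eps.lTensor N (n ⊗ₜ one)) = n
      simp [hH.eps_one])
    (by
      ext1 t
      apply Subtype.ext
      have ht : (TensorProduct.assoc k N H H).symm (delta.lTensor N (t.1 : N ⊗[k] H))
          = (t.1 : N ⊗[k] H) ⊗ₜ one := t.2
      have key : ∀ s : N ⊗[k] H, ((TensorProduct.rid k N).toLinearMap ∘ₗ eps.lTensor N).rTensor H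
          ((TensorProduct.assoc k N H H).symm (delta.lTensor N s)) = s := by
        intro s
        induction s with
        | zero => simp
        | add s t hs ht => simp only [map_add, hs, ht]
        | tmul n x =>
          conv_rhs => rw [← hH.counit_left x]
          simp only [LinearMap.lTensor_tmul]
          generalize delta x = w
          induction w with
          | zero => simp
          | add s t hs ht => simp only [map_add, TensorProduct.tmul_add, hs, ht]
          | tmul a b => simp [TensorProduct.smul_tmul]
      have := key t.1
      rw [ht] at this
      exact this)

end HopfMod

open CategoryTheory

variable (k H mul one eps delta lam) in
/-- The coinvariants functor `M ↦ M^{coH}`. -/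
def coinvFunctor : HopfMod k H mul one eps delta lam ⥤ ModuleCat.{0} k where
  obj X := ModuleCat.of k (coinvSub k H one X.rho)
  map {X Y} f := ModuleCat.ofHom (f.1.restrict fun m (hm : X.rho m = m ⊗ₜ one) => by
    change Y.rho (f.1 m) = f.1 m ⊗ₜ one
    have h := LinearMap.congr_fun f.2.1 m
    simpa [hm] using h)
  map_id _ := rfl
  map_comp _ _ := rfl

theorem coinvFunctor_faithful (hH : IsHopfQuasigroup k H mul one eps delta lam) :
    (coinvFunctor k H mul one eps delta lam).Faithful where
  map_injective {X Y f g} hfg := by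
    have hco : ∀ n : X.coinv, f.1 n = g.1 n := fun n =>
      congrArg Subtype.val (LinearMap.congr_fun (congrArg ModuleCat.Hom.hom hfg) n)
    refine Subtype.ext (LinearMap.ext fun m => ?_)
    obtain ⟨t, rfl⟩ := (X.omega hH).surjective m
    induction t with
    | zero => simp
    | add s t hs ht => simp only [map_add, hs, ht]
    | tmul n x =>
      have hf := LinearMap.congr_fun f.2.2 ((n : X.M) ⊗ₜ x)
      have hg := LinearMap.congr_fun g.2.2 ((n : X.M) ⊗ₜ x)
      simp only [LinearMap.comp_apply, X.dphi_coinv hH, LinearMap.rTensor_tmul] at hf hg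
      rw [hf, hg, hco]

/-- The morphism of Hopf modules induced by a linear map between coinvariants. -/
def HopfMod.homOfCoinv (hH : IsHopfQuasigroup k H mul one eps delta lam)
    {X Y : HopfMod k H mul one eps delta lam} (g : X.coinv →ₗ[k] Y.coinv) : X ⟶ Y :=
  have happ : ∀ t, ((Y.omega hH).toLinearMap ∘ₗ g.rTensor H ∘ₗ (X.omega hH).symm.toLinearMap)
      (X.omega hH t) = Y.omega hH (g.rTensor H t) := fun t => by simp
  ⟨(Y.omega hH).toLinearMap ∘ₗ g.rTensor H ∘ₗ (X.omega hH).symm.toLinearMap, by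
    generalize (Y.omega hH).toLinearMap ∘ₗ g.rTensor H ∘ₗ (X.omega hH).symm.toLinearMap = f
      at happ
    constructor
    · ext1 m
      obtain ⟨t, rfl⟩ := (X.omega hH).surjective m
      simp only [LinearMap.comp_apply, happ]
      induction t with
      | zero => simp
      | add s t hs ht => simp only [map_add, hs, ht]
      | tmul n x =>
        rw [LinearMap.rTensor_tmul, Y.rho_omega hH, X.rho_omega hH,
          ← LinearMap.comp_apply (LinearMap.rTensor H f), ← LinearMap.rTensor_comp]
        congr 2
        ext y
        simp only [LinearMap.comp_apply, LinearEquiv.coe_coe, happ, TensorProduct.mk_apply,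
          LinearMap.rTensor_tmul]
    · refine TensorProduct.ext' fun m y => ?_
      obtain ⟨t, rfl⟩ := (X.omega hH).surjective m
      simp only [LinearMap.comp_apply, LinearMap.rTensor_tmul, happ]
      induction t with
      | zero => simp
      | add s t hs ht => simp only [map_add, TensorProduct.add_tmul, hs, ht]
      | tmul n x =>
        rw [X.dphi_omega hH, happ, LinearMap.rTensor_tmul, LinearMap.rTensor_tmul,
          Y.dphi_omega hH]⟩

theorem HopfMod.homOfCoinv_coinv (hH : IsHopfQuasigroup k H mul one eps delta lam)
    {X Y : HopfMod k H mul one eps delta lam} (g : X.coinv →ₗ[k] Y.coinv) (n : X.coinv) :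
    (HopfMod.homOfCoinv hH g).1 (n : X.M) = g n := by
  have hn : X.omega hH (n ⊗ₜ one) = n := by rw [omega_tmul, X.ax.act_one]
  have hm : (X.omega hH).symm n = n ⊗ₜ one := by rw [← hn, LinearEquiv.symm_apply_apply]
  simp [homOfCoinv, hm, Y.ax.act_one]

theorem coinvFunctor_full (hH : IsHopfQuasigroup k H mul one eps delta lam) :
    (coinvFunctor k H mul one eps delta lam).Full where
  map_surjective g :=
    ⟨HopfMod.homOfCoinv hH g.hom, ModuleCat.hom_ext (LinearMap.ext fun n =>
      Subtype.ext (HopfMod.homOfCoinv_coinv hH g.hom n))⟩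

theorem coinvFunctor_isEquivalence (hH : IsHopfQuasigroup k H mul one eps delta lam) :
    (coinvFunctor k H mul one eps delta lam).IsEquivalence where
  faithful := coinvFunctor_faithful hH
  full := coinvFunctor_full hH
  essSurj := ⟨fun N => ⟨HopfMod.free hH N, ⟨(HopfMod.freeCoinvEquiv hH N).toModuleIso⟩⟩⟩

variable (k H mul one eps delta lam)

/-- For a Hopf quasigroup `H`, the category of right `H`-Hopf modules is equivalent to
the category of `k`-vector spaces, the equivalence being given by the coinvariants
functor `M ↦ M^{coH}` (with quasi-inverse `N ↦ (N ⊗ H, id ⊗ μ, id ⊗ δ)`). -/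
theorem hopf_module_category_equivalence
    (hH : IsHopfQuasigroup k H mul one eps delta lam) :
    ∃ e : CategoryTheory.Equivalence
        (HopfMod k H mul one eps delta lam) (ModuleCat.{0} k),
      ∀ X : HopfMod k H mul one eps delta lam,
        e.functor.obj X = ModuleCat.of k (coinvSub k H one X.rho) := by
  have := coinvFunctor_isEquivalence hH
  exact ⟨(coinvFunctor k H mul one eps delta lam).asEquivalence, fun _ => rfl⟩
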